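/- arXiv:2502.10981 — 2 statements merged into one kernel-verified Lean document; each statement's English description precedes it below -/
import Mathlib

section
/- For every integer n ≥ 1 and every integer k ≥ 2, the minimum forcing number of the Cartesian product of the complete bipartite graph K_{n,n} with the cycle on 2k vertices satisfies f(K_{n,n} □ C_{2k}) = 2n. -/
open SimpleGraph

noncomputable def forcingNumber {V : Type*} (G : SimpleGraph V) (M : G.Subgraph) : ℕ :=
  sInf {c | ∃ S : Set (Sym2 V), S ⊆ M.edgeSet ∧ S.ncard = c ∧
    ∀ M' : G.Subgraph, M'.IsPerfectMatching → S ⊆ M'.edgeSet → M' = M}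

noncomputable def minForcingNumber {V : Type*} (G : SimpleGraph V) : ℕ :=
  sInf {c | ∃ M : G.Subgraph, M.IsPerfectMatching ∧ forcingNumber G M = c}


theorem Fin.val_add_one_eq_ite {m : ℕ} [NeZero m] (i : Fin m) :
    (i + 1).val = if i.val + 1 = m then 0 else i.val + 1 := by
  split_ifs with h
  · rw [Fin.val_add, Fin.val_one', Nat.add_mod_mod, h, Nat.mod_self]
  · rw [Fin.val_add, Fin.val_one', Nat.add_mod_mod, Nat.mod_eq_of_lt (by have := i.2; omega)]

theorem Fin.val_sub_one_eq_ite {m : ℕ} [NeZero m] (i : Fin m) :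
    (i - 1).val = if i.val = 0 then m - 1 else i.val - 1 := by
  have h := Fin.val_add_one_eq_ite (i - 1)
  rw [sub_add_cancel] at h
  have h1 := i.2
  have h2 := (i - 1).2
  split_ifs at h ⊢ <;> omega

theorem cycleGraph_adj_iff {m : ℕ} [NeZero m] (hm : 3 ≤ m) (i j : Fin m) :
    (cycleGraph m).Adj i j ↔ j = i + 1 ∨ j = i - 1 := by
  have h1 : ((1 : Fin m) : ℕ) = 1 := by rw [Fin.val_one', Nat.mod_eq_of_lt (by omega)]
  rw [cycleGraph_adj', ← h1, Fin.val_inj, Fin.val_inj, sub_eq_iff_eq_add, sub_eq_iff_eq_add,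
    eq_sub_iff_add_eq, or_comm, add_comm 1 i, add_comm 1 j, eq_comm (a := i)]

namespace SimpleGraph.Subgraph

variable {V : Type*} {G : SimpleGraph V}

/-- The spanning subgraph whose edges join each vertex to its image under an involution. -/
def ofInvolution (m : V → V) (hadj : ∀ v, G.Adj v (m v)) (hinv : ∀ v, m (m v) = v) :
    G.Subgraph where
  verts := Set.univ
  Adj u v := m u = v
  adj_sub := by rintro u v rfl; exact hadj u
  edge_vert := fun _ => Set.mem_univ _
  symm := ⟨by rintro u v rfl; exact hinv u⟩

theorem isPerfectMatching_ofInvolution (m : V → V) (hadj : ∀ v, G.Adj v (m v))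
    (hinv : ∀ v, m (m v) = v) : (ofInvolution m hadj hinv).IsPerfectMatching :=
  isPerfectMatching_iff.2 fun v => ⟨m v, rfl, fun _ (h : m v = _) => h.symm⟩

theorem IsPerfectMatching.eq_of_adj {M M' : G.Subgraph} (hM : M.IsPerfectMatching)
    (hM' : M'.IsPerfectMatching) (h : ∀ u v, M.Adj u v → M'.Adj u v) : M' = M := by
  rw [isPerfectMatching_iff] at *
  ext u v
  · obtain ⟨w, hw, -⟩ := hM u
    obtain ⟨w', hw', -⟩ := hM' u
    exact iff_of_true hw'.fst_mem hw.fst_mem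
  · refine ⟨fun h' => ?_, h u v⟩
    obtain ⟨w, hw, -⟩ := hM u
    rwa [(hM' u).unique h' (h u w hw)]

/-- A perfect matching of a bipartite graph can be changed away from the edges on which a nonzero
vector of the kernel of a weighted adjacency matrix vanishes. -/
theorem IsPerfectMatching.exists_ne_of_kernel [Fintype V] (col : V → Bool)
    (hcol : ∀ u v, G.Adj u v → col u ≠ col v) (w : V → V → ℚ)
    (hw : ∀ u v, w u v ≠ 0 ↔ G.Adj u v) (x : V → ℚ) (hx : x ≠ 0)
    (hker : ∀ u, ∑ v, w u v * x v = 0) {M : G.Subgraph} (hM : M.IsPerfectMatching)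
    {S : Set (Sym2 V)} (hS : S ⊆ M.edgeSet) (hSx : ∀ e ∈ S, ∀ v ∈ e, x v = 0) :
    ∃ M' : G.Subgraph, M'.IsPerfectMatching ∧ S ⊆ M'.edgeSet ∧ M' ≠ M := by
  classical
  obtain ⟨u₀, hu₀⟩ := Function.ne_iff.1 hx
  choose m hm hm_unique using isPerfectMatching_iff.1 hM
  have hinv (v) : m (m v) = v := (hm_unique _ _ (hm v).symm).symm
  have hmadj (v) : G.Adj v (m v) := (hm v).adj_sub
  have hstep (u : V) (hu : x u ≠ 0) : ∃ v, v ≠ u ∧ x v ≠ 0 ∧ G.Adj (m u) v := by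
    by_contra! h
    have hsum := hker (m u)
    rw [Finset.sum_eq_single u] at hsum
    · exact mul_ne_zero ((hw _ _).2 (hmadj u).symm) hu hsum
    · intro v _ hv
      by_cases hxv : x v = 0
      · simp [hxv]
      · have := mt (hw (m u) v).1 (h v hv hxv)
        simp [not_not.1 this]
    · simp
  choose! g hg_ne hg_x hg_adj using hstep
  have hcol_eq {a b : Bool} (h : a ≠ b) (c : Bool) (h' : a ≠ c) : b = c := by
    revert a b c; decide
  have hg_col (u) (hu : x u ≠ 0) : col (g u) = col u :=
    hcol_eq (hcol _ _ (hg_adj u hu)) _ (hcol _ _ (hmadj u).symm)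
  have hiter (t : ℕ) : x (g^[t] u₀) ≠ 0 ∧ col (g^[t] u₀) = col u₀ := by
    induction t with
    | zero => exact ⟨hu₀, rfl⟩
    | succ t ih =>
      rw [Function.iterate_succ_apply']
      exact ⟨hg_x _ ih.1, (hg_col _ ih.1).trans ih.2⟩
  obtain ⟨z, hzx, hzc, hzp⟩ : ∃ z, x z ≠ 0 ∧ col z = col u₀ ∧ z ∈ Function.periodicPts g := by
    obtain ⟨a, b, hab, h⟩ := Finite.exists_ne_map_eq_of_infinite (fun t : ℕ => g^[t] u₀)
    wlog hlt : a < b generalizing a b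
    · exact this b a hab.symm h.symm (by omega)
    refine ⟨g^[a] u₀, (hiter a).1, (hiter a).2, Function.mk_mem_periodicPts (n := b - a)
      (by omega) ?_⟩
    rw [Function.IsPeriodicPt, Function.IsFixedPt, ← Function.iterate_add_apply,
      Nat.sub_add_cancel hlt.le]
    exact h.symm
  let C : Set V := {v | v ∈ Function.periodicPts g ∧ x v ≠ 0 ∧ col v = col u₀}
  have hgC {v} (hv : v ∈ C) : g v ∈ C :=
    ⟨(Function.bijOn_periodicPts g).mapsTo hv.1, hg_x v hv.2.1, (hg_col v hv.2.1).trans hv.2.2⟩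
  let s : V → V := fun v => if v ∈ C then g v else v
  have hs_inj : Function.Injective s := by
    intro a b h
    simp only [s] at h
    split_ifs at h with ha hb hb
    · exact (Function.bijOn_periodicPts g).injOn ha.1 hb.1 h
    · exact absurd (h ▸ hgC ha) hb
    · exact absurd (h ▸ hgC hb) ha
    · exact h
  let σ : Equiv.Perm V := Equiv.ofBijective s (Finite.injective_iff_bijective.1 hs_inj)
  have hσ_mem {v} (hv : v ∈ C) : σ v = g v := if_pos hv
  have hσ_not {v} (hv : v ∉ C) : σ v = v := if_neg hv
  have hσ_col (v) : col (σ v) = col v := by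
    by_cases hv : v ∈ C
    · rw [hσ_mem hv, hg_col v hv.2.1]
    · rw [hσ_not hv]
  have hσ_adj (v) : G.Adj (m v) (σ v) := by
    by_cases hv : v ∈ C
    · rw [hσ_mem hv]; exact hg_adj v hv.2.1
    · rw [hσ_not hv]; exact (hmadj v).symm
  let m' : V → V := fun v => if col v = col u₀ then m (σ.symm v) else σ (m v)
  have hm'_pos {v} (hv : col v = col u₀) : m' v = m (σ.symm v) := if_pos hv
  have hm'_neg {v} (hv : col v ≠ col u₀) : m' v = σ (m v) := if_neg hv
  have hm'_adj (v) : G.Adj v (m' v) := by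
    by_cases hv : col v = col u₀
    · rw [hm'_pos hv]
      simpa using (hσ_adj (σ.symm v)).symm
    · rw [hm'_neg hv]
      simpa [hinv] using hσ_adj (m v)
  have hm'_inv (v) : m' (m' v) = v := by
    have h := hcol _ _ (hm'_adj v)
    by_cases hv : col v = col u₀
    · rw [hm'_neg (v := m' v) (by rwa [← hv, ne_comm]), hm'_pos hv, hinv,
        Equiv.apply_symm_apply]
    · rw [hm'_pos (v := m' v) (hcol_eq h _ hv), hm'_neg hv, Equiv.symm_apply_apply, hinv]
  refine ⟨ofInvolution m' hm'_adj hm'_inv, isPerfectMatching_ofInvolution _ _ _, ?_, ?_⟩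
  · have hfix {a b} (hab : M.Adj a b) (ha : x a = 0) (hb : x b = 0) : m' a = b := by
      have hb' : b = m a := hm_unique _ _ hab
      by_cases hc : col a = col u₀
      · have : σ a = a := hσ_not fun h => h.2.1 ha
        rw [hm'_pos hc, hb', σ.symm_apply_eq.2 this.symm]
      · rw [hm'_neg hc, ← hb', hσ_not fun h => h.2.1 hb]
    intro e he
    induction e with
    | _ a b => exact hfix (hS he) (hSx _ he a (by simp)) (hSx _ he b (by simp))
  · intro h
    have hadj : m' (m z) = z := by
      have : (ofInvolution m' hm'_adj hm'_inv).Adj (m z) z := by rw [h]; exact (hm z).symm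
      exact this
    have hz : z ∈ C := ⟨hzp, hzx, hzc⟩
    rw [hm'_neg (by rw [← hzc]; exact (hcol _ _ (hmadj z)).symm), hinv, hσ_mem hz] at hadj
    exact hg_ne z hzx hadj

end SimpleGraph.Subgraph

theorem Fin.even_val_add_one {m : ℕ} [NeZero m] (hm : Even m) (i : Fin m) :
    Even (i + 1).val ↔ ¬ Even i.val := by
  rw [Fin.val_add_one_eq_ite]
  split_ifs with h
  · rw [← h, Nat.even_add_one] at hm
    simpa using hm
  · rw [Nat.even_add_one]

theorem Fin.even_val_sub_one {m : ℕ} [NeZero m] (hm : Even m) (i : Fin m) :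
    Even (i - 1).val ↔ ¬ Even i.val := by
  rw [← not_iff_not, not_not, ← Fin.even_val_add_one hm, sub_add_cancel]

section Kernel

variable {U : Type*} [DecidableEq U] {m : ℕ}

/-- Weights on the edges of `H □ cycleGraph m`, built from weights `W` on the edges of `H` and from
the coefficients of the linear relations between values of an affine function at three points. -/
def boxCycleWeight [NeZero m] (W : Matrix U U ℚ) (y z : U × Fin m) : ℚ :=
  (if z.2 = y.2 then (((y.2 - 1 : Fin m).val : ℚ) - ((y.2 + 1 : Fin m).val : ℚ)) * W y.1 z.1
    else 0) +
  (if z.2 = y.2 - 1 then if y.1 = z.1 then ((y.2 + 1 : Fin m).val : ℚ) - (y.2.val : ℚ) else 0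
    else 0) +
  (if z.2 = y.2 + 1 then if y.1 = z.1 then (y.2.val : ℚ) - ((y.2 - 1 : Fin m).val : ℚ) else 0
    else 0)

/-- The vectors `(u, i) ↦ (W ^ i *ᵥ (a + i • b)) u` for an involution `W`. -/
def boxCycleKernel [Fintype U] (m : ℕ) (W : Matrix U U ℚ) :
    (U → ℚ) × (U → ℚ) →ₗ[ℚ] (U × Fin m → ℚ) where
  toFun f y := if Even y.2.val then f.1 y.1 + y.2.val * f.2 y.1
    else (W.mulVec f.1) y.1 + y.2.val * (W.mulVec f.2) y.1
  map_add' f g := by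
    ext y
    simp only [Prod.fst_add, Prod.snd_add, Pi.add_apply, Matrix.mulVec_add]
    split_ifs <;> ring
  map_smul' c f := by
    ext y
    simp only [Prod.smul_fst, Prod.smul_snd, Pi.smul_apply, Matrix.mulVec_smul, smul_eq_mul,
      RingHom.id_apply]
    split_ifs <;> ring

theorem boxCycleWeight_ne_zero_iff [NeZero m] (hm : 3 ≤ m) {H : SimpleGraph U} {W : Matrix U U ℚ}
    (hW : ∀ u v, W u v ≠ 0 ↔ H.Adj u v) (y z : U × Fin m) :
    boxCycleWeight W y z ≠ 0 ↔ (H □ cycleGraph m).Adj y z := by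
  obtain ⟨u, i⟩ := y
  obtain ⟨v, j⟩ := z
  have hp := Fin.val_sub_one_eq_ite i
  have hq := Fin.val_add_one_eq_ite i
  have hi := i.2
  have h1 : i ≠ i - 1 := fun h => by have := congrArg Fin.val h; split_ifs at * <;> omega
  have h2 : i ≠ i + 1 := fun h => by have := congrArg Fin.val h; split_ifs at * <;> omega
  have h3 : i - 1 ≠ i + 1 := fun h => by have := congrArg Fin.val h; split_ifs at * <;> omega
  have h1' : (i.val : ℚ) - ((i - 1 : Fin m).val : ℚ) ≠ 0 := by
    rw [sub_ne_zero, Ne, Nat.cast_inj, Fin.val_inj]; exact h1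
  have h2' : ((i + 1 : Fin m).val : ℚ) - (i.val : ℚ) ≠ 0 := by
    rw [sub_ne_zero, Ne, Nat.cast_inj, Fin.val_inj]; exact h2.symm
  have h3' : ((i - 1 : Fin m).val : ℚ) - ((i + 1 : Fin m).val : ℚ) ≠ 0 := by
    rw [sub_ne_zero, Ne, Nat.cast_inj, Fin.val_inj]; exact h3
  rw [boxProd_adj, cycleGraph_adj_iff hm, ← hW]
  simp only [boxCycleWeight]
  by_cases hj : j = i
  · subst hj
    simp [h1, h2, h3']
  by_cases hj1 : j = i - 1
  · subst hj1
    by_cases huv : u = v <;> simp [h1, h1.symm, h3, h2', huv]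
  by_cases hj2 : j = i + 1
  · subst hj2
    by_cases huv : u = v <;> simp [h2, h2.symm, h3.symm, h1', huv]
  simp [hj, hj1, hj2, Ne.symm hj]

theorem sum_boxCycleWeight_mul_boxCycleKernel [Fintype U] [NeZero m] (hm : Even m)
    {W : Matrix U U ℚ} (hW : W * W = 1)
    (f : (U → ℚ) × (U → ℚ)) (y : U × Fin m) :
    ∑ z, boxCycleWeight W y z * boxCycleKernel m W f z = 0 := by
  obtain ⟨u, i⟩ := y
  have hWW (g : U → ℚ) : ∑ v, W u v * W.mulVec g v = g u := by
    have : W.mulVec (W.mulVec g) = g := by rw [Matrix.mulVec_mulVec, hW, Matrix.one_mulVec]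
    exact congrFun this u
  have hW1 (g : U → ℚ) : ∑ v, W u v * g v = W.mulVec g u := rfl
  have key (a b c : ℚ) (g h : U → ℚ) : ∑ v, a * W u v * (g v + b * h v) =
      a * (∑ v, W u v * g v + b * ∑ v, W u v * h v) := by
    rw [Finset.mul_sum, ← Finset.sum_add_distrib, Finset.mul_sum]
    exact Finset.sum_congr rfl fun v _ => by ring
  simp only [boxCycleWeight, boxCycleKernel, LinearMap.coe_mk, AddHom.coe_mk,
    Fintype.sum_prod_type, add_mul, Finset.sum_add_distrib, ite_mul, zero_mul, Finset.sum_ite_eq',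
    Finset.sum_ite_eq, Finset.mem_univ, if_true, Fin.even_val_add_one hm, Fin.even_val_sub_one hm]
  by_cases hi : Even i.val
  · simp only [hi, if_true, not_true, if_false, key _ _ 0, hW1]
    ring
  · simp only [hi, if_true, not_false_eq_true, if_false, key _ _ 0, hWW]
    ring

theorem boxCycleKernel_injective [Fintype U] (hm : 2 ≤ m) {W : Matrix U U ℚ} (hW : W * W = 1) :
    Function.Injective (boxCycleKernel m W) := by
  rw [← LinearMap.ker_eq_bot, LinearMap.ker_eq_bot']
  rintro ⟨a, b⟩ h
  have h0 (u) := congrFun h (u, ⟨0, by omega⟩)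
  have h1 (u) := congrFun h (u, ⟨1, by omega⟩)
  simp only [boxCycleKernel, LinearMap.coe_mk, AddHom.coe_mk, Even.zero, Nat.not_even_one, if_true,
    if_false, Nat.cast_zero, Nat.cast_one, zero_mul, one_mul, add_zero, Pi.zero_apply] at h0 h1
  obtain rfl : a = 0 := funext h0
  have hb : W.mulVec b = 0 := by ext u; simpa using h1 u
  have : b = 0 := by rw [← Matrix.one_mulVec b, ← hW, ← Matrix.mulVec_mulVec, hb, Matrix.mulVec_zero]
  rw [this]; rfl

/-- If a bipartite graph `H` has a weighted adjacency matrix which is an involution, then every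
forcing set in `H □ cycleGraph m`, for even `m`, has at least as many edges as `H` has vertices. -/
theorem card_le_ncard_of_forcing [Fintype U] [NeZero m] (hm : 3 ≤ m) (hm' : Even m)
    {H : SimpleGraph U} (c : U → Bool)
    (hc : ∀ u v, H.Adj u v → c u ≠ c v) {W : Matrix U U ℚ} (hW : W * W = 1)
    (hWH : ∀ u v, W u v ≠ 0 ↔ H.Adj u v) {M : (H □ cycleGraph m).Subgraph}
    (hM : M.IsPerfectMatching) {S : Set (Sym2 (U × Fin m))} (hS : S ⊆ M.edgeSet)
    (hforce : ∀ M' : (H □ cycleGraph m).Subgraph, M'.IsPerfectMatching → S ⊆ M'.edgeSet → M' = M) :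
    Fintype.card U ≤ S.ncard := by
  classical
  by_contra! hlt
  let T : Finset (U × Fin m) := S.toFinite.toFinset.biUnion Sym2.toFinset
  have hT : T.card ≤ S.ncard * 2 := by
    rw [Set.ncard_eq_toFinset_card S]
    refine Finset.card_biUnion_le_card_mul _ _ _ fun e _ => ?_
    rw [Sym2.card_toFinset]
    split_ifs <;> omega
  let L := (LinearMap.funLeft ℚ ℚ (Subtype.val : T → U × Fin m)).comp (boxCycleKernel m W)
  have hL : LinearMap.ker L ≠ ⊥ := by
    apply LinearMap.ker_ne_bot_of_finrank_lt
    rw [Module.finrank_prod, Module.finrank_fintype_fun_eq_card, Module.finrank_fintype_fun_eq_card,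
      Fintype.card_coe]
    omega
  obtain ⟨f, hf, hf0⟩ := (Submodule.ne_bot_iff _).1 hL
  have hcol (y z : U × Fin m) (h : (H □ cycleGraph m).Adj y z) :
      xor (c y.1) (decide (Even y.2.val)) ≠ xor (c z.1) (decide (Even z.2.val)) := by
    have hdec {a b : ℕ} (hab : Even a ↔ ¬ Even b) : decide (Even a) = !decide (Even b) := by
      rw [← decide_not, decide_eq_decide]
      exact hab
    rw [boxProd_adj, cycleGraph_adj_iff hm] at h
    rcases h with ⟨h, h'⟩ | ⟨h | h, h'⟩
    · rw [h']
      simpa using hc _ _ h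
    · rw [h, h', hdec (Fin.even_val_add_one hm' y.2)]
      simp
    · rw [h, h', hdec (Fin.even_val_sub_one hm' y.2)]
      simp
  obtain ⟨M', h1, h2, h3⟩ := hM.exists_ne_of_kernel _ hcol (boxCycleWeight W)
    (boxCycleWeight_ne_zero_iff hm hWH) (boxCycleKernel m W f)
    (fun h => hf0 (boxCycleKernel_injective (by omega) hW (h.trans (map_zero _).symm)))
    (sum_boxCycleWeight_mul_boxCycleKernel hm' hW f) hS (fun e he v hv =>
      congrFun (LinearMap.mem_ker.1 hf) ⟨v, Finset.mem_biUnion.2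
        ⟨e, by simpa using he, Sym2.mem_toFinset.2 hv⟩⟩)
  exact h3 (hforce M' h1 h2)

end Kernel

theorem exists_involutive_weight_completeBipartiteGraph (n : ℕ) :
    ∃ W : Matrix (Fin n ⊕ Fin n) (Fin n ⊕ Fin n) ℚ, W * W = 1 ∧
      ∀ u v, W u v ≠ 0 ↔ (completeBipartiteGraph (Fin n) (Fin n)).Adj u v := by
  let J : Matrix (Fin n) (Fin n) ℚ := Matrix.of fun _ _ => 1
  have hJ : J * J = (n : ℚ) • J := by
    ext i j
    simp [J, Matrix.mul_apply]
  have hn : (n : ℚ) + 1 ≠ 0 := by positivity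
  have h1 : (1 + J) * (1 - ((n : ℚ) + 1)⁻¹ • J) = 1 := by
    rw [mul_sub, add_mul, one_mul, mul_one, Matrix.mul_smul, add_mul, hJ, one_mul]
    ext i j
    simp only [Matrix.sub_apply, Matrix.add_apply, Matrix.smul_apply, smul_eq_mul]
    field_simp
    ring
  have h2 := mul_eq_one_comm.1 h1
  have hpos (i j) : (1 + J) i j ≠ 0 := by
    simp only [Matrix.add_apply, Matrix.one_apply, J, Matrix.of_apply]
    split_ifs <;> norm_num
  have hneg (i j) (hn' : 1 ≤ n) : (1 - ((n : ℚ) + 1)⁻¹ • J) i j ≠ 0 := by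
    have : (1 : ℚ) ≤ n := by exact_mod_cast hn'
    simp only [Matrix.sub_apply, Matrix.one_apply, J, Matrix.of_apply, Matrix.smul_apply,
      smul_eq_mul, mul_one]
    split_ifs
    · rw [sub_ne_zero, ne_comm, Ne, inv_eq_one]
      linarith
    · simpa using hn
  refine ⟨Matrix.fromBlocks 0 (1 + J) (1 - ((n : ℚ) + 1)⁻¹ • J) 0, ?_, ?_⟩
  · rw [Matrix.fromBlocks_multiply]
    simp [h1, h2]
  · rintro (i | i) (j | j)
    · simp
    · simpa using hpos i j
    · simpa using hneg i j (by have := i.2; omega)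
    · simp

section Forcing

variable {U : Type*} {m : ℕ} [NeZero m]

/-- In `H □ cycleGraph m` with `H` bipartite and `m` even, the perfect matching which matches the
two colour classes along complementary alternate edges of the cycles is forced by one edge in each
of the cycles. -/
theorem exists_forcing_boxProd_cycleGraph [Fintype U] (hm : 3 ≤ m) (hm' : Even m)
    {H : SimpleGraph U} (c : U → Bool) (hc : ∀ u v, H.Adj u v → c u ≠ c v) :
    ∃ M : (H □ cycleGraph m).Subgraph, M.IsPerfectMatching ∧ ∃ S ⊆ M.edgeSet,
      S.ncard ≤ Fintype.card U ∧ ∀ M' : (H □ cycleGraph m).Subgraph,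
        M'.IsPerfectMatching → S ⊆ M'.edgeSet → M' = M := by
  have hadd := Fin.even_val_add_one hm'
  have hsub := Fin.even_val_sub_one hm'
  let p : U × Fin m → U × Fin m := fun y =>
    if c y.1 = true ↔ Even y.2.val then (y.1, y.2 + 1) else (y.1, y.2 - 1)
  have hp_up {u i} (h : c u = true ↔ Even i.val) : p (u, i) = (u, i + 1) := if_pos h
  have hp_down {u i} (h : ¬ (c u = true ↔ Even i.val)) : p (u, i) = (u, i - 1) := if_neg h
  have hp_adj (y) : (H □ cycleGraph m).Adj y (p y) := by
    obtain ⟨u, i⟩ := y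
    rw [boxProd_adj, cycleGraph_adj_iff hm]
    by_cases h : c u = true ↔ Even i.val
    · simp [hp_up h]
    · simp [hp_down h]
  have hp_inv (y) : p (p y) = y := by
    obtain ⟨u, i⟩ := y
    by_cases h : c u = true ↔ Even i.val
    · rw [hp_up h, hp_down (by rw [hadd]; tauto), add_sub_cancel_right]
    · rw [hp_down h, hp_up (by rw [hsub]; tauto), sub_add_cancel]
  let start : U → Fin m := fun u => if c u then ⟨0, by omega⟩ else ⟨1, by omega⟩
  have hstart (u) : c u = true ↔ Even (start u).val := by
    by_cases h : c u <;> simp [start, h]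
  refine ⟨.ofInvolution p hp_adj hp_inv, Subgraph.isPerfectMatching_ofInvolution _ _ _,
    Set.range fun u => s((u, start u), (u, start u + 1)), ?_, ?_, ?_⟩
  · rintro _ ⟨u, rfl⟩
    exact hp_up (hstart u)
  · rw [← Set.image_univ]
    exact (Set.ncard_image_le).trans_eq (by rw [Set.ncard_univ, Nat.card_eq_fintype_card])
  · intro M' hM' hSM'
    have huniq {x y z} (hy : M'.Adj x y) (hz : M'.Adj x z) : y = z :=
      (Subgraph.isPerfectMatching_iff.1 hM' x).unique hy hz
    have key (t : ℕ) : ∀ (i : Fin m) (u : U), i.val = t → (c u = true ↔ Even i.val) →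
        M'.Adj (u, i) (u, i + 1) := by
      induction t using Nat.strong_induction_on with
      | _ t ih =>
      intro i u hit hup
      by_cases ht : t < 2
      · obtain rfl : i = start u := by
          apply Fin.ext
          rw [hit] at hup ⊢
          interval_cases t
          · simp [start, hup.2 Even.zero]
          · have : ¬ c u = true := fun h => Nat.not_even_one (hup.1 h)
            simp [start, this]
        exact hSM' ⟨u, rfl⟩
      have hv1 := Fin.val_sub_one_eq_ite i
      rw [if_neg (by omega)] at hv1
      have hv2 := Fin.val_sub_one_eq_ite (i - 1)
      rw [if_neg (by omega)] at hv2
      obtain ⟨⟨v, j⟩, hvj, -⟩ := Subgraph.isPerfectMatching_iff.1 hM' (u, i)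
      have hadj := hvj.adj_sub
      rw [boxProd_adj, cycleGraph_adj_iff hm] at hadj
      rcases hadj with ⟨h, h'⟩ | ⟨h | h, h'⟩ <;> dsimp only at h h' <;> subst h'
      · have hcol := hc _ _ h
        have hv := ih (t - 1) (by omega) (i - 1) v (by omega) (by
          rw [hsub, ← hup]
          cases hcu : c u <;> cases hcv : c v <;> simp_all)
        rw [sub_add_cancel] at hv
        exact absurd (congrArg (fun y => c y.1) (huniq hvj.symm hv.symm)) hcol
      · rwa [h] at hvj
      · rw [h] at hvj
        have hv := ih (t - 2) (by omega) (i - 1 - 1) u (by omega) (by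
          rw [hsub, hsub, hup, not_not])
        rw [sub_add_cancel] at hv
        have := congrArg (fun y => y.2.val) (huniq hvj.symm hv.symm)
        dsimp only at this
        omega
    refine (Subgraph.isPerfectMatching_ofInvolution p hp_adj hp_inv).eq_of_adj hM' ?_
    rintro ⟨u, i⟩ y (h : p (u, i) = y)
    subst h
    by_cases h : c u = true ↔ Even i.val
    · rw [hp_up h]
      exact key _ i u rfl h
    · rw [hp_down h]
      have := key _ (i - 1) u rfl (by rw [hsub]; tauto)
      rw [sub_add_cancel] at this
      exact this.symm

/-- The minimum forcing number of `H □ cycleGraph m`, for even `m`, is the number of vertices of `H`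
when `H` is bipartite and has a weighted adjacency matrix which is an involution. -/
theorem minForcingNumber_boxProd_cycleGraph [Fintype U] [DecidableEq U] (hm : 3 ≤ m)
    (hm' : Even m) {H : SimpleGraph U} (c : U → Bool) (hc : ∀ u v, H.Adj u v → c u ≠ c v)
    {W : Matrix U U ℚ} (hW : W * W = 1) (hWH : ∀ u v, W u v ≠ 0 ↔ H.Adj u v) :
    minForcingNumber (H □ cycleGraph m) = Fintype.card U := by
  obtain ⟨M, hM, S, hS, hcard, hforce⟩ :=
    exists_forcing_boxProd_cycleGraph (m := m) hm hm' c hc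
  apply le_antisymm
  · have h1 : minForcingNumber (H □ cycleGraph m) ≤ forcingNumber _ M := Nat.sInf_le ⟨M, hM, rfl⟩
    have h2 : forcingNumber _ M ≤ S.ncard := Nat.sInf_le ⟨S, hS, rfl, hforce⟩
    exact h1.trans (h2.trans hcard)
  · refine le_csInf ⟨_, M, hM, rfl⟩ ?_
    rintro _ ⟨M₁, hM₁, rfl⟩
    refine le_csInf ⟨_, M₁.edgeSet, subset_rfl, rfl, fun M' hM' h => hM₁.eq_of_adj hM' ?_⟩ ?_
    · exact fun u v huv => h (show s(u, v) ∈ M₁.edgeSet from huv)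
    · rintro _ ⟨S₁, hS₁, rfl, hforce₁⟩
      exact card_le_ncard_of_forcing hm hm' c hc hW hWH hM₁ hS₁ hforce₁

end Forcing

theorem stmt13 (n : ℕ) (hn : 1 ≤ n) (k : ℕ) (hk : 2 ≤ k) :
    minForcingNumber (completeBipartiteGraph (Fin n) (Fin n) □ cycleGraph (2 * k)) = 2 * n := by
  have : NeZero (2 * k) := ⟨by omega⟩
  obtain ⟨W, hW, hWH⟩ := exists_involutive_weight_completeBipartiteGraph n
  rw [minForcingNumber_boxProd_cycleGraph (by omega) (even_two_mul k) Sum.isLeft ?_ hW hWH,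
    Fintype.card_sum, Fintype.card_fin, two_mul]
  rintro (u | u) (v | v) <;> simp
end

section
/- Let G be a finite simple bipartite graph with bipartition (X,Y), |X| = m, |Y| = n, m ≤ n, and suppose there exist two weighted bi-adjacency matrices B and C of G over a field F (both with rows indexed by X and columns by Y) such that B·Cᵀ = I_m. Then the minimum forcing number of the prism over G satisfies f(G □ K_2) = m. -/
open SimpleGraph

theorem SimpleGraph.Subgraph.IsPerfectMatching.eq_of_adj_imp {V : Type*} {G : SimpleGraph V}
    {M M' : G.Subgraph} (hM : M.IsPerfectMatching) (hM' : M'.IsPerfectMatching)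
    (h : ∀ u v, M.Adj u v → M'.Adj u v) : M = M' := by
  refine Subgraph.ext ?_ ?_
  · rw [Subgraph.isSpanning_iff.mp hM.2, Subgraph.isSpanning_iff.mp hM'.2]
  · ext u v
    refine ⟨h u v, fun huv => ?_⟩
    obtain ⟨w, hw, -⟩ := Subgraph.isPerfectMatching_iff.mp hM u
    rwa [(Subgraph.isPerfectMatching_iff.mp hM' u).unique huv (h u w hw)]

theorem forcingNumber_spec {V : Type*} {G : SimpleGraph V} {M : G.Subgraph}
    (hM : M.IsPerfectMatching) :
    ∃ S : Set (Sym2 V), S ⊆ M.edgeSet ∧ S.ncard = forcingNumber G M ∧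
      ∀ M' : G.Subgraph, M'.IsPerfectMatching → S ⊆ M'.edgeSet → M' = M := by
  refine Nat.sInf_mem (s := {c | ∃ S : Set (Sym2 V), S ⊆ M.edgeSet ∧ S.ncard = c ∧
    ∀ M' : G.Subgraph, M'.IsPerfectMatching → S ⊆ M'.edgeSet → M' = M})
    ⟨_, M.edgeSet, subset_rfl, rfl, fun M' hM' hS => ?_⟩
  refine (hM.eq_of_adj_imp hM' fun u v huv => ?_).symm
  exact Subgraph.mem_edgeSet.mp (hS (Subgraph.mem_edgeSet.mpr huv))

section Bipartite

variable {V ι : Type*} {H : SimpleGraph V} {e : ι ⊕ ι ≃ V}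

/-- The matching of a bipartite graph with parts `e ∘ Sum.inl` and `e ∘ Sum.inr` given by a
permutation. -/
def permMatching (H : SimpleGraph V) (e : ι ⊕ ι ≃ V) (π : Equiv.Perm ι)
    (hπ : ∀ i, H.Adj (e (.inl i)) (e (.inr (π i)))) : H.Subgraph where
  verts := Set.univ
  Adj u v := (∃ i, u = e (.inl i) ∧ v = e (.inr (π i))) ∨
    ∃ i, v = e (.inl i) ∧ u = e (.inr (π i))
  adj_sub := by
    rintro u v (⟨i, rfl, rfl⟩ | ⟨i, rfl, rfl⟩)
    exacts [hπ i, (hπ i).symm]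
  edge_vert _ := Set.mem_univ _
  symm := ⟨fun _ _ h => h.symm⟩

theorem permMatching_isPerfectMatching {π : Equiv.Perm ι}
    (hπ : ∀ i, H.Adj (e (.inl i)) (e (.inr (π i)))) :
    (permMatching H e π hπ).IsPerfectMatching := by
  rw [Subgraph.isPerfectMatching_iff]
  intro v
  obtain ⟨i | j, rfl⟩ := e.surjective v
  · refine ⟨e (.inr (π i)), Or.inl ⟨i, rfl, rfl⟩, ?_⟩
    rintro w (⟨k, hk, rfl⟩ | ⟨k, rfl, hk⟩) <;> simp_all
  · refine ⟨e (.inl (π.symm j)), Or.inr ⟨π.symm j, rfl, by simp⟩, ?_⟩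
    rintro w (⟨k, hk, rfl⟩ | ⟨k, rfl, hk⟩) <;> simp_all

theorem exists_perm_of_isPerfectMatching [Finite ι]
    (hl : ∀ i j, ¬ H.Adj (e (.inl i)) (e (.inl j)))
    {M : H.Subgraph} (hM : M.IsPerfectMatching) :
    ∃ σ : Equiv.Perm ι, ∀ i j, M.Adj (e (.inl i)) (e (.inr j)) ↔ j = σ i := by
  have hM' := Subgraph.isPerfectMatching_iff.mp hM
  have h : ∀ i, ∃ j, M.Adj (e (.inl i)) (e (.inr j)) := by
    intro i
    obtain ⟨w, hw, -⟩ := hM' (e (.inl i))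
    obtain ⟨k | j, rfl⟩ := e.surjective w
    · exact absurd hw.adj_sub (hl i k)
    · exact ⟨j, hw⟩
  choose s hs using h
  have hinj : Function.Injective s := fun i k hik => by
    have h2 := hs k
    rw [← hik] at h2
    simpa using (hM' (e (.inr (s i)))).unique (hs i).symm h2.symm
  refine ⟨Equiv.ofBijective s (Finite.injective_iff_bijective.mp hinj), fun i j => ?_⟩
  constructor
  · intro hij
    simpa using (hM' (e (.inl i))).unique hij (hs i)
  · rintro rfl
    exact hs i

/-- Deleting a forcing set leaves a nonsingular square submatrix of the weighted bi-adjacency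
matrix. -/
theorem exists_det_submatrix_ne_zero_of_forcing [Fintype V] [Fintype ι] [DecidableEq ι]
    {F : Type*} [Field F] (N : Matrix ι ι F)
    (hl : ∀ i j, ¬ H.Adj (e (.inl i)) (e (.inl j)))
    (hr : ∀ i j, ¬ H.Adj (e (.inr i)) (e (.inr j)))
    (hN : ∀ i j, N i j ≠ 0 ↔ H.Adj (e (.inl i)) (e (.inr j)))
    {M : H.Subgraph} (hM : M.IsPerfectMatching) {S : Set (Sym2 V)} (hS : S ⊆ M.edgeSet)
    (hforce : ∀ M' : H.Subgraph, M'.IsPerfectMatching → S ⊆ M'.edgeSet → M' = M) :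
    ∃ (U : Finset ι) (g : U → ι), Fintype.card ι ≤ U.card + S.ncard ∧
      (N.submatrix ((↑) : U → ι) g).det ≠ 0 := by
  classical
  obtain ⟨σ, hσ⟩ := exists_perm_of_isPerfectMatching hl hM
  set U : Finset ι := {i | s(e (.inl i), e (.inr (σ i))) ∉ S} with hU
  refine ⟨U, fun u => σ u, ?_, ?_⟩
  · have hc : Uᶜ.card ≤ S.ncard := by
      rw [← Set.ncard_coe_finset]
      refine Set.ncard_le_ncard_of_injOn (fun i => s(e (.inl i), e (.inr (σ i)))) ?_ ?_
        (Set.toFinite S)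
      · intro i hi
        simpa [hU] using hi
      · intro i _ j _ hij
        simpa using hij
    have := U.card_add_card_compl
    omega
  · rw [Matrix.det_apply, Finset.sum_eq_single 1]
    · simp only [Equiv.Perm.sign_one, one_smul, Equiv.Perm.one_apply, Matrix.submatrix_apply]
      exact Finset.prod_ne_zero_iff.mpr fun u _ =>
        (hN _ _).mpr ((hσ _ _).mpr rfl).adj_sub
    · intro τ _ hτ
      by_contra hne
      have hprod : ∀ u : U, N (τ u) (σ u) ≠ 0 := by
        intro u h0
        apply hne
        rw [Finset.prod_eq_zero (Finset.mem_univ u) h0, smul_zero]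
      let π : Equiv.Perm ι := (Equiv.Perm.ofSubtype τ⁻¹).trans σ
      have hπin : ∀ u : U, π u = σ ((τ⁻¹ u : U) : ι) := fun u =>
        congrArg σ (Equiv.Perm.ofSubtype_apply_coe τ⁻¹ u)
      have hπout : ∀ i, i ∉ U → π i = σ i := fun i hi => by
        simp only [π, Equiv.trans_apply]
        rw [Equiv.Perm.ofSubtype_apply_of_not_mem _ hi]
      have hπ : ∀ i, H.Adj (e (.inl i)) (e (.inr (π i))) := by
        intro i
        by_cases hi : i ∈ U
        · rw [hπin ⟨i, hi⟩, ← hN]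
          simpa using hprod (τ⁻¹ ⟨i, hi⟩)
        · rw [hπout i hi]
          exact ((hσ _ _).mpr rfl).adj_sub
      have hadj : ∀ i j, M.Adj (e (.inl i)) (e (.inr j)) → s(e (.inl i), e (.inr j)) ∈ S →
          (permMatching H e π hπ).Adj (e (.inl i)) (e (.inr j)) := by
        intro i j hij hmem
        obtain rfl := (hσ i j).mp hij
        exact Or.inl ⟨i, rfl, by rw [hπout i (by simpa [hU] using hmem)]⟩
      have hMeq := hforce _ (permMatching_isPerfectMatching hπ) (by
        intro z hz
        have hzM := hS hz
        induction z with
        | h u v =>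
          rw [Subgraph.mem_edgeSet] at hzM ⊢
          obtain ⟨i | i, rfl⟩ := e.surjective u <;> obtain ⟨j | j, rfl⟩ := e.surjective v
          · exact absurd hzM.adj_sub (hl _ _)
          · exact hadj i j hzM hz
          · exact (hadj j i hzM.symm (Sym2.eq_swap ▸ hz)).symm
          · exact absurd hzM.adj_sub (hr _ _))
      apply hτ
      refine inv_eq_one.mp (Equiv.ext fun u => ?_)
      have h1 : M.Adj (e (.inl (u : ι))) (e (.inr (π u))) := by
        rw [← hMeq]
        exact Or.inl ⟨_, rfl, rfl⟩
      have h2 := (hσ _ _).mp h1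
      rw [hπin u] at h2
      exact Subtype.ext (σ.injective h2)
    · simp

end Bipartite

section Prism

variable {X Y : Type*}

/-- The bipartition of the prism over a bipartite graph with parts `X` and `Y`. -/
def prismEquiv (X Y : Type*) : (X ⊕ Y) ⊕ (X ⊕ Y) ≃ (X ⊕ Y) × Fin 2 where
  toFun := Sum.elim (Sum.elim (fun x => (.inl x, 0)) fun y => (.inr y, 1))
    (Sum.elim (fun x => (.inl x, 1)) fun y => (.inr y, 0))
  invFun p := match p with
    | (.inl x, 0) => .inl (.inl x)
    | (.inl x, 1) => .inr (.inl x)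
    | (.inr y, 0) => .inr (.inr y)
    | (.inr y, 1) => .inl (.inr y)
  left_inv := by rintro ((x | y) | (x | y)) <;> rfl
  right_inv := by
    rintro ⟨x | y, i⟩ <;> fin_cases i <;> rfl

/-- The perfect matching of the prism over `G` joining the two copies of each vertex. -/
def prismMatching {V : Type*} (G : SimpleGraph V) :
    (G □ (⊤ : SimpleGraph (Fin 2))).Subgraph where
  verts := Set.univ
  Adj u v := u.1 = v.1 ∧ u.2 ≠ v.2
  adj_sub := by
    rintro u v ⟨h1, h2⟩
    exact boxProd_adj.mpr (Or.inr ⟨h2, h1⟩)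
  edge_vert _ := Set.mem_univ _
  symm := ⟨fun _ _ h => ⟨h.1.symm, h.2.symm⟩⟩

theorem prismMatching_isPerfectMatching {V : Type*} (G : SimpleGraph V) :
    (prismMatching G).IsPerfectMatching := by
  rw [Subgraph.isPerfectMatching_iff]
  rintro ⟨v, i⟩
  refine ⟨(v, i + 1), ⟨rfl, by simp⟩, ?_⟩
  rintro ⟨w, j⟩ ⟨h1, h2⟩
  refine Prod.ext h1.symm ?_
  change i ≠ j at h2
  change j = i + 1
  omega

theorem forcingNumber_prismMatching_le [Fintype X] (G : SimpleGraph (X ⊕ Y))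
    (hbip : ∀ u v, G.Adj u v → u.isLeft ≠ v.isLeft) :
    forcingNumber (G □ (⊤ : SimpleGraph (Fin 2))) (prismMatching G) ≤ Fintype.card X := by
  refine Nat.sInf_le
    ⟨Set.range fun x : X => s(((.inl x : X ⊕ Y), (0 : Fin 2)), (.inl x, 1)), ?_, ?_, ?_⟩
  · rintro _ ⟨x, rfl⟩
    exact ⟨rfl, zero_ne_one⟩
  · rw [← Nat.card_eq_fintype_card, ← Nat.card_coe_set_eq]
    refine Nat.card_range_of_injective fun x x' h => ?_
    simpa using h
  · intro M' hM' hS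
    refine hM'.eq_of_adj_imp (prismMatching_isPerfectMatching G) ?_
    have hx : ∀ (x : X) (i : Fin 2) (v : (X ⊕ Y) × Fin 2), M'.Adj (.inl x, i) v →
        v.1 = .inl x := by
      intro x i v hv
      have h01 : M'.Adj (.inl x, 0) (.inl x, 1) := hS ⟨x, rfl⟩
      have hM'' := Subgraph.isPerfectMatching_iff.mp hM' (.inl x, i)
      fin_cases i
      · exact congrArg Prod.fst (hM''.unique hv h01)
      · exact congrArg Prod.fst (hM''.unique hv h01.symm)
    intro u v huv
    rcases boxProd_adj.mp huv.adj_sub with ⟨h, -⟩ | ⟨h, h'⟩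
    · exfalso
      obtain ⟨x | y, i⟩ := u
      · exact h.ne (hx x i v huv).symm
      · obtain ⟨x | y', j⟩ := v
        · exact h.ne (hx x j _ huv.symm)
        · exact hbip _ _ h rfl
    · exact ⟨h', h⟩

end Prism

open Matrix in
theorem stmt15 {X Y F : Type*} [Fintype X] [Fintype Y] [DecidableEq X] [DecidableEq Y] [Field F]
    (G : SimpleGraph (X ⊕ Y))
    (hbip : ∀ u v, G.Adj u v → u.isLeft ≠ v.isLeft)
    (hmn : Fintype.card X ≤ Fintype.card Y)
    (B C : Matrix X Y F)
    (hB : ∀ x y, B x y ≠ 0 ↔ G.Adj (Sum.inl x) (Sum.inr y))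
    (hC : ∀ x y, C x y ≠ 0 ↔ G.Adj (Sum.inl x) (Sum.inr y))
    (hBC : B * Cᵀ = 1) :
    minForcingNumber (G □ (⊤ : SimpleGraph (Fin 2))) = Fintype.card X := by
  have hll : ∀ x x', ¬ G.Adj (.inl x) (.inl x') := fun x x' h => hbip _ _ h rfl
  have hrr : ∀ y y', ¬ G.Adj (.inr y) (.inr y') := fun y y' h => hbip _ _ h rfl
  apply le_antisymm
  · refine le_trans (Nat.sInf_le ?_) (forcingNumber_prismMatching_le G hbip)
    exact ⟨_, prismMatching_isPerfectMatching G, rfl⟩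
  · refine le_csInf ⟨_, _, prismMatching_isPerfectMatching G, rfl⟩ ?_
    rintro _ ⟨M, hM, rfl⟩
    obtain ⟨S, hS, hcard, hforce⟩ := forcingNumber_spec hM
    rw [← hcard]
    have hfactor : fromBlocks 1 B Cᵀ 1 = fromRows B 1 * fromCols Cᵀ 1 := by
      rw [fromRows_mul_fromCols, hBC]
      simp
    obtain ⟨U, g, hU, hdet⟩ := exists_det_submatrix_ne_zero_of_forcing
      (e := prismEquiv X Y) (fromBlocks 1 B Cᵀ 1)
      (by rintro (x | y) (x' | y') <;> simp [prismEquiv, boxProd_adj, hll, hrr])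
      (by rintro (x | y) (x' | y') <;> simp [prismEquiv, boxProd_adj, hll, hrr])
      (by
        rintro (x | y) (x' | y')
        · simp [prismEquiv, boxProd_adj, Matrix.one_apply]
        · simpa [prismEquiv, boxProd_adj] using hB x y'
        · simpa [prismEquiv, boxProd_adj, G.adj_comm (.inr y)] using hC x' y
        · simp [prismEquiv, boxProd_adj, Matrix.one_apply])
      hM hS hforce
    have hrank := Matrix.rank_of_isUnit _ ((Matrix.isUnit_iff_isUnit_det _).mpr hdet.isUnit)
    rw [hfactor, Matrix.submatrix_mul _ _ _ id _ Function.bijective_id] at hrank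
    have h1 := Matrix.rank_mul_le_left
      ((fromRows B (1 : Matrix Y Y F)).submatrix ((↑) : U → X ⊕ Y) id)
      ((fromCols Cᵀ (1 : Matrix Y Y F)).submatrix id g)
    have h2 := Matrix.rank_le_card_width
      ((fromRows B (1 : Matrix Y Y F)).submatrix ((↑) : U → X ⊕ Y) id)
    rw [hrank, Fintype.card_coe] at h1
    rw [Fintype.card_sum] at hU
    omega
end
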